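/- (Comparison of the Leclerc and Ingermanson minors, type A.) In the Marsh–Rietsch setup over ℝ with all parameters t_r > 0: the matrix gᵀ·ẇ admits a UDL factorization gᵀẇ = y₊·y₀·y₋; set y⃗ := y₊ and z_Ing := (ẇ·y₀·y₋·ẇ⁻¹)ᵀ. Then: (1) z_Ing ∈ B₋, and g = z_Ing·ẇ·b for some b ∈ B₋; (2) for every i ∈ {1,…,n−1}, Δ^{w({i+1,…,n})}_{v({i+1,…,n})}(z_Ingᵀ) = 1; (3) for every r ∈ {1,…,m}, Δ^{(s_{i_1}∘···∘s_{i_{r−1}})({i_r+1,…,n})}_{(s^v_{i_1}∘···∘s^v_{i_{r−1}})({i_r+1,…,n})}(z_Ingᵀ) = Δ^{(s^v_{i_m}∘···∘s^v_{i_r})({1,…,i_r})}_{(s_{i_m}∘···∘s_{i_r})({1,…,i_r})}(y⃗) (empty compositions denote the identity permutation). -/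

import Mathlib

open Matrix Finset

namespace Paper

open scoped Classical

noncomputable section

variable {K : Type*} [Field K] {n m : ℕ}

/-- `N`: upper unitriangular matrices. -/
def IsN (g : Matrix (Fin n) (Fin n) K) : Prop :=
  (∀ i, g i i = 1) ∧ ∀ i j : Fin n, j < i → g i j = 0

/-- `N₋`: lower unitriangular matrices. -/
def IsNm (g : Matrix (Fin n) (Fin n) K) : Prop :=
  (∀ i, g i i = 1) ∧ ∀ i j : Fin n, i < j → g i j = 0

/-- `B`: upper triangular matrices of determinant 1. -/
def IsB (g : Matrix (Fin n) (Fin n) K) : Prop :=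
  g.det = 1 ∧ ∀ i j : Fin n, j < i → g i j = 0

/-- `B₋`: lower triangular matrices of determinant 1. -/
def IsBm (g : Matrix (Fin n) (Fin n) K) : Prop :=
  g.det = 1 ∧ ∀ i j : Fin n, i < j → g i j = 0

/-- `H`: diagonal matrices of determinant 1. -/
def IsH (g : Matrix (Fin n) (Fin n) K) : Prop :=
  g.det = 1 ∧ ∀ i j : Fin n, i ≠ j → g i j = 0

/-- UDL factorization: `g = yp * y0 * ym` with `yp ∈ N`, `y0 ∈ H`, `ym ∈ N₋`. -/
def UDL (g yp y0 ym : Matrix (Fin n) (Fin n) K) : Prop :=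
  IsN yp ∧ IsH y0 ∧ IsNm ym ∧ g = yp * y0 * ym

/-- LDU factorization: `g = zm * z0 * zp` with `zm ∈ N₋`, `z0 ∈ H`, `zp ∈ N`. -/
def LDU (g zm z0 zp : Matrix (Fin n) (Fin n) K) : Prop :=
  IsNm zm ∧ IsH z0 ∧ IsN zp ∧ g = zm * z0 * zp

/-- The signed permutation matrix `v̇`. -/
def pdot (v : Equiv.Perm (Fin n)) : Matrix (Fin n) (Fin n) K :=
  Matrix.of fun a b : Fin n =>
    if a = v b then
      (-1 : K) ^ (univ.filter fun k : Fin n => b < k ∧ v k < v b).card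
    else 0

/-- Membership in the double coset `B₋ w B₋`. -/
def InBmWBm (w : Equiv.Perm (Fin n)) (g : Matrix (Fin n) (Fin n) K) : Prop :=
  ∃ b₁ b₂ : Matrix (Fin n) (Fin n) K, IsBm b₁ ∧ IsBm b₂ ∧ g = b₁ * pdot w * b₂

/-- `Δ^I_J(g)`: the minor with row set `I` and column set `J` (junk value 0 if sizes differ). -/
def minor (g : Matrix (Fin n) (Fin n) K) (I J : Finset (Fin n)) : K :=
  if h : I.card = J.card then
    Matrix.det (Matrix.of fun a b : Fin I.card =>
      g (I.orderEmbOfFin rfl a) (J.orderEmbOfFin h.symm b))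
  else 0

/-- All right-aligned flag minors of `g` are nonnegative. -/
def RightFlagNonneg (g : Matrix (Fin n) (Fin n) ℝ) : Prop :=
  ∀ I : Finset (Fin n),
    0 ≤ minor g I (univ.filter fun j : Fin n => n - I.card ≤ (j : ℕ))

/-- All top-aligned flag minors of `g` are nonnegative. -/
def TopFlagNonneg (g : Matrix (Fin n) (Fin n) ℝ) : Prop :=
  ∀ J : Finset (Fin n),
    0 ≤ minor g (univ.filter fun i : Fin n => (i : ℕ) < J.card) J

/-- `x_i(t)` (with 1-based `i`): `Id + t·E_{i,i+1}`. -/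
def xmat (i : ℕ) (t : K) : Matrix (Fin n) (Fin n) K :=
  Matrix.of fun a b : Fin n =>
    if a = b then 1 else if (a : ℕ) + 1 = i ∧ (b : ℕ) = i then t else 0

/-- `y_i(t)` (with 1-based `i`): `Id + t·E_{i+1,i}`. -/
def ymat (i : ℕ) (t : K) : Matrix (Fin n) (Fin n) K :=
  Matrix.of fun a b : Fin n =>
    if a = b then 1 else if (a : ℕ) = i ∧ (b : ℕ) + 1 = i then t else 0

/-- `ṡ_i` (with 1-based `i`). -/
def sdot (i : ℕ) : Matrix (Fin n) (Fin n) K :=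
  Matrix.of fun a b : Fin n =>
    if (a : ℕ) + 1 = i ∧ (b : ℕ) = i then 1
    else if (a : ℕ) = i ∧ (b : ℕ) + 1 = i then -1
    else if a = b ∧ (a : ℕ) + 1 ≠ i ∧ (a : ℕ) ≠ i then 1
    else 0

/-- The adjacent transposition `s_i` (with 1-based `i`); identity if out of range. -/
def sperm (n : ℕ) (i : ℕ) : Equiv.Perm (Fin n) :=
  if h : i < n then
    Equiv.swap ⟨i - 1, Nat.lt_of_le_of_lt (Nat.sub_le i 1) h⟩ ⟨i, h⟩
  else 1

/-- `ℓ(w)`: the number of inversions of `w`. -/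
def len (w : Equiv.Perm (Fin n)) : ℕ :=
  (univ.filter fun p : Fin n × Fin n => p.1 < p.2 ∧ w p.2 < w p.1).card

/-- `vseq ii v k = v_{(m-k)}`: the rightmost (positive distinguished) subexpression recursion. -/
def vseq (ii : Fin m → ℕ) (v : Equiv.Perm (Fin n)) : ℕ → Equiv.Perm (Fin n)
  | 0 => v
  | k + 1 =>
    if h : m - k - 1 < m then
      if len (vseq ii v k * sperm n (ii ⟨m - k - 1, h⟩)) < len (vseq ii v k) then
        vseq ii v k * sperm n (ii ⟨m - k - 1, h⟩)
      else vseq ii v k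
    else vseq ii v k

/-- `r ∈ J°` (0-based `r`, corresponding to the 1-based index `r+1`). -/
def inJ (ii : Fin m → ℕ) (v : Equiv.Perm (Fin n)) (r : Fin m) : Prop :=
  vseq ii v (m - (r : ℕ)) = vseq ii v (m - (r : ℕ) - 1)

/-- The list `[s_{i_1}, …, s_{i_m}]` of adjacent transpositions. -/
def sPermList (n : ℕ) (ii : Fin m → ℕ) : List (Equiv.Perm (Fin n)) :=
  List.ofFn fun r => sperm n (ii r)

/-- The list `[s^v_{i_1}, …, s^v_{i_m}]`. -/
def svPermList (ii : Fin m → ℕ) (v : Equiv.Perm (Fin n)) : List (Equiv.Perm (Fin n)) :=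
  List.ofFn fun r => if inJ ii v r then 1 else sperm n (ii r)

/-- The factors `g_1, …, g_m` of the Marsh–Rietsch element. -/
def mrgList (ii : Fin m → ℕ) (v : Equiv.Perm (Fin n)) (t : Fin m → K) :
    List (Matrix (Fin n) (Fin n) K) :=
  List.ofFn fun r => if inJ ii v r then xmat (ii r) (t r) else sdot (ii r)

/-- The Marsh–Rietsch element `g = g_1 ⋯ g_m`. -/
def mrg (ii : Fin m → ℕ) (v : Equiv.Perm (Fin n)) (t : Fin m → K) :
    Matrix (Fin n) (Fin n) K :=
  (mrgList ii v t).prod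

/-- The list `[ṡ_{i_1}, …, ṡ_{i_m}]`. -/
def sdotList (n : ℕ) (ii : Fin m → ℕ) : List (Matrix (Fin n) (Fin n) K) :=
  List.ofFn fun r => sdot (ii r)

/-- `ẇ = ṡ_{i_1} ⋯ ṡ_{i_m}`. -/
def wMR (n : ℕ) (ii : Fin m → ℕ) : Matrix (Fin n) (Fin n) K :=
  (sdotList n ii).prod

/-! ### Lengths -/

lemma len_subadd (x y : Equiv.Perm (Fin n)) : len (x * y) ≤ len x + len y := by
  unfold len
  have hsub : (univ.filter fun p : Fin n × Fin n => p.1 < p.2 ∧ (x * y) p.2 < (x * y) p.1) ⊆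
      ((univ.filter fun p : Fin n × Fin n => p.1 < p.2 ∧ x p.2 < x p.1).image
        (fun p => (y.symm p.1, y.symm p.2))) ∪
      (univ.filter fun p : Fin n × Fin n => p.1 < p.2 ∧ y p.2 < y p.1) := by
    rintro ⟨p, q⟩ h
    simp only [Finset.mem_filter, Finset.mem_univ, true_and, Finset.mem_union,
      Finset.mem_image, Prod.mk.injEq, Prod.exists] at h ⊢
    simp only [Equiv.Perm.mul_apply] at h ⊢
    by_cases hc : y q < y p
    · exact Or.inr ⟨h.1, hc⟩
    · left
      refine ⟨y p, y q, ⟨lt_of_le_of_ne (not_lt.mp hc) ?_, h.2⟩, by simp, by simp⟩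
      intro e
      exact h.1.ne (y.injective e)
  exact (Finset.card_le_card hsub).trans ((Finset.card_union_le _ _).trans
    (Nat.add_le_add_right Finset.card_image_le _))

lemma len_inv_le (x : Equiv.Perm (Fin n)) : len x ≤ len x⁻¹ := by
  unfold len
  apply Finset.card_le_card_of_injOn (fun p => (x p.2, x p.1))
  · rintro ⟨p, q⟩ h
    simpa [and_comm] using h
  · rintro ⟨p, q⟩ _ ⟨p', q'⟩ _ h
    simp at h
    simp [h]

lemma len_inv (x : Equiv.Perm (Fin n)) : len x⁻¹ = len x :=
  le_antisymm (by simpa using len_inv_le x⁻¹) (len_inv_le x)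

lemma len_one : len (1 : Equiv.Perm (Fin n)) = 0 := by
  unfold len
  rw [Finset.card_eq_zero, Finset.filter_eq_empty_iff]
  rintro ⟨p, q⟩ _ h
  simp at h
  omega

lemma swap_lt {a b : Fin n} (hab : (a : ℕ) + 1 = b) {p q : Fin n} (h : p < q)
    (hne : ¬ (p = a ∧ q = b)) : Equiv.swap a b p < Equiv.swap a b q := by
  simp only [Equiv.swap_apply_def]
  simp only [Fin.ext_iff, Fin.lt_def] at *
  split_ifs <;> omega

lemma len_mul_swap_of_asc (x : Equiv.Perm (Fin n)) {a b : Fin n} (hab : (a : ℕ) + 1 = b)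
    (h : x a < x b) : len (x * Equiv.swap a b) = len x + 1 := by
  unfold len
  have hlt : a < b := by rw [Fin.lt_def]; omega
  have key : (univ.filter fun p : Fin n × Fin n =>
        p.1 < p.2 ∧ (x * Equiv.swap a b) p.2 < (x * Equiv.swap a b) p.1) =
      insert (a, b) ((univ.filter fun p : Fin n × Fin n => p.1 < p.2 ∧ x p.2 < x p.1).image
        (fun p => (Equiv.swap a b p.1, Equiv.swap a b p.2))) := by
    ext ⟨p, q⟩
    simp only [Finset.mem_filter, Finset.mem_univ, true_and, Finset.mem_insert,
      Finset.mem_image, Prod.mk.injEq, Prod.exists]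
    simp only [Equiv.Perm.mul_apply]
    constructor
    · rintro ⟨h1, h2⟩
      by_cases hc : p = a ∧ q = b
      · exact Or.inl hc
      · right
        exact ⟨_, _, ⟨swap_lt hab h1 hc, h2⟩, by simp, by simp⟩
    · rintro (⟨rfl, rfl⟩ | ⟨p', q', ⟨h1, h2⟩, rfl, rfl⟩)
      · simpa using ⟨hlt, h⟩
      · refine ⟨swap_lt hab h1 ?_, by simpa using h2⟩
        rintro ⟨rfl, rfl⟩
        exact absurd h2 (not_lt.mpr h.le)
  rw [key, Finset.card_insert_of_notMem, Finset.card_image_of_injective]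
  · rintro ⟨p, q⟩ ⟨p', q'⟩ h
    simpa using h
  · simp only [Finset.mem_image, Finset.mem_filter, Finset.mem_univ, true_and, Prod.mk.injEq, Prod.exists]
    rintro ⟨p, q, ⟨h1, -⟩, h2, h3⟩
    have e1 : p = b := by simpa using congrArg (Equiv.swap a b) h2
    have e2 : q = a := by simpa using congrArg (Equiv.swap a b) h3
    subst e1 e2
    exact absurd h1 (not_lt.mpr hlt.le)

lemma len_mul_swap_of_desc (x : Equiv.Perm (Fin n)) {a b : Fin n} (hab : (a : ℕ) + 1 = b)
    (h : ¬ x a < x b) : len (x * Equiv.swap a b) + 1 = len x := by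
  have hlt : a < b := by rw [Fin.lt_def]; omega
  have h' : x b < x a := lt_of_le_of_ne (not_lt.mp h) (fun e => hlt.ne' (x.injective e))
  have := len_mul_swap_of_asc (x * Equiv.swap a b) hab (by simpa using h')
  rw [mul_assoc, Equiv.swap_mul_self, mul_one] at this
  exact this.symm

lemma sperm_eq {a b : Fin n} (hab : (a : ℕ) + 1 = b) : sperm n (b : ℕ) = Equiv.swap a b := by
  unfold sperm
  rw [dif_pos b.2]
  congr 1
  apply Fin.ext
  simp
  omega

lemma exists_ab {i : ℕ} (h : 1 ≤ i ∧ i < n) : ∃ a b : Fin n, (a : ℕ) + 1 = b ∧ (b : ℕ) = i :=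
  ⟨⟨i - 1, by omega⟩, ⟨i, h.2⟩, by simp; omega, rfl⟩

/-- ascent -/
def Asc (x : Equiv.Perm (Fin n)) (i : ℕ) : Prop :=
  ∀ a b : Fin n, (a : ℕ) + 1 = b → (b : ℕ) = i → x a < x b

lemma asc_iff (x : Equiv.Perm (Fin n)) {a b : Fin n} (hab : (a : ℕ) + 1 = b) :
    Asc x (b : ℕ) ↔ x a < x b := by
  constructor
  · intro h; exact h a b hab rfl
  · intro h a' b' h1 h2
    have e2 : b' = b := Fin.ext h2
    have e1 : a' = a := Fin.ext (by omega)
    rw [e1, e2]; exact h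

lemma len_asc {x : Equiv.Perm (Fin n)} {i : ℕ} (hi : 1 ≤ i ∧ i < n) (h : Asc x i) :
    len (x * sperm n i) = len x + 1 := by
  obtain ⟨a, b, hab, rfl⟩ := exists_ab hi
  rw [sperm_eq hab]
  exact len_mul_swap_of_asc x hab ((asc_iff x hab).1 h)

lemma asc_of_len {x : Equiv.Perm (Fin n)} {i : ℕ} (hi : 1 ≤ i ∧ i < n)
    (h : ¬ len (x * sperm n i) < len x) : Asc x i := by
  obtain ⟨a, b, hab, rfl⟩ := exists_ab hi
  rw [asc_iff x hab]
  by_contra hc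
  rw [sperm_eq hab] at h
  have := len_mul_swap_of_desc x hab hc
  omega

lemma sperm_sq (i : ℕ) : sperm n i * sperm n i = 1 := by
  unfold sperm
  split_ifs <;> simp

lemma sperm_inv (i : ℕ) : (sperm n i)⁻¹ = sperm n i :=
  inv_eq_of_mul_eq_one_left (sperm_sq i)

lemma len_sperm {i : ℕ} (hi : 1 ≤ i ∧ i < n) : len (sperm n i) = 1 := by
  have := len_asc (x := 1) hi (by
    intro a b h _; rw [Fin.lt_def]; simp; omega)
  simpa [len_one] using this

/-! ### Words -/

/-- letters: index, flag (true = simple reflection), parameter -/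
abbrev Lt := ℕ × Bool × ℝ

def spL (n : ℕ) (l : Lt) : Equiv.Perm (Fin n) := if l.2.1 then sperm n l.1 else 1
def gL (n : ℕ) (l : Lt) : Matrix (Fin n) (Fin n) ℝ :=
  if l.2.1 then sdot l.1 else xmat l.1 l.2.2
def sdL (n : ℕ) (l : Lt) : Matrix (Fin n) (Fin n) ℝ := if l.2.1 then sdot l.1 else 1
def wL (l : Lt) : Lt := (l.1, true, 0)

def sp (n : ℕ) (L : List Lt) : Equiv.Perm (Fin n) := (L.map (spL n)).prod
def gg (n : ℕ) (L : List Lt) : Matrix (Fin n) (Fin n) ℝ := (L.map (gL n)).prod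
def sd (n : ℕ) (L : List Lt) : Matrix (Fin n) (Fin n) ℝ := (L.map (sdL n)).prod
def ws (L : List Lt) : List Lt := L.map wL

lemma sp_cons (l : Lt) (L : List Lt) : sp n (l :: L) = spL n l * sp n L := by simp [sp]
lemma gg_cons (l : Lt) (L : List Lt) : gg n (l :: L) = gL n l * gg n L := by simp [gg]
lemma sd_cons (l : Lt) (L : List Lt) : sd n (l :: L) = sdL n l * sd n L := by simp [sd]
lemma sp_nil : sp n [] = 1 := rfl
lemma gg_nil : gg n [] = 1 := rfl
lemma sd_nil : sd n [] = 1 := rfl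
lemma sp_append (L M : List Lt) : sp n (L ++ M) = sp n L * sp n M := by simp [sp]
lemma gg_append (L M : List Lt) : gg n (L ++ M) = gg n L * gg n M := by simp [gg]
lemma sd_append (L M : List Lt) : sd n (L ++ M) = sd n L * sd n M := by simp [sd]
lemma ws_cons (l : Lt) (L : List Lt) : ws (l :: L) = wL l :: ws L := rfl
lemma ws_append (L M : List Lt) : ws (L ++ M) = ws L ++ ws M := by simp [ws]

def Valid (n : ℕ) (L : List Lt) : Prop := ∀ l ∈ L, 1 ≤ l.1 ∧ l.1 < n

lemma Valid.ws {L : List Lt} (h : Valid n L) : Valid n (ws L) := by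
  intro l hl
  simp only [Paper.ws, List.mem_map] at hl
  obtain ⟨l', h', rfl⟩ := hl
  exact h l' h'

lemma Valid.tail {l : Lt} {L : List Lt} (h : Valid n (l :: L)) : Valid n L :=
  fun x hx => h x (List.mem_cons_of_mem _ hx)

lemma Valid.head {l : Lt} {L : List Lt} (h : Valid n (l :: L)) : 1 ≤ l.1 ∧ l.1 < n :=
  h l List.mem_cons_self

lemma Valid.left {L M : List Lt} (h : Valid n (L ++ M)) : Valid n L :=
  fun x hx => h x (List.mem_append_left _ hx)

lemma Valid.right {L M : List Lt} (h : Valid n (L ++ M)) : Valid n M :=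
  fun x hx => h x (List.mem_append_right _ hx)

def Dist : Equiv.Perm (Fin n) → List Lt → Prop
  | _, [] => True
  | x, l :: L => Asc x l.1 ∧ Dist (x * spL n l) L

lemma Dist.left {x : Equiv.Perm (Fin n)} {L M : List Lt} (h : Dist x (L ++ M)) : Dist x L := by
  induction L generalizing x with
  | nil => trivial
  | cons l L ih => exact ⟨h.1, ih h.2⟩

lemma Dist.cancel {x y : Equiv.Perm (Fin n)} {L : List Lt} (hL : Valid n L)
    (h : Dist (x * y) L) (hl : len (x * y) = len x + len y) : Dist y L := by
  induction L generalizing y with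
  | nil => trivial
  | cons l L ih =>
    have h1 := len_asc hL.head h.1
    have h2 := len_subadd x (y * sperm n l.1)
    rw [← mul_assoc] at h2
    have ha : Asc y l.1 := asc_of_len hL.head (by omega)
    have h3 := len_asc hL.head ha
    refine ⟨ha, ih hL.tail (by rw [← mul_assoc]; exact h.2) ?_⟩
    unfold spL
    split_ifs
    · rw [← mul_assoc]; omega
    · simpa using hl

lemma Dist.tail {l : Lt} {L : List Lt} (hL : Valid n L)
    (h : Dist (1 : Equiv.Perm (Fin n)) (l :: L)) : Dist (1 : Equiv.Perm (Fin n)) L := by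
  refine Dist.cancel (x := spL n l) hL ?_ (by simp [len_one])
  have := h.2
  rwa [one_mul] at this

lemma Dist.right {L M : List Lt} (hL : Valid n (L ++ M))
    (h : Dist (1 : Equiv.Perm (Fin n)) (L ++ M)) : Dist (1 : Equiv.Perm (Fin n)) M := by
  induction L with
  | nil => exact h
  | cons l L ih => exact ih (Valid.tail hL) (Dist.tail (Valid.tail hL) h)

lemma Dist.len {x : Equiv.Perm (Fin n)} {L : List Lt} (hL : Valid n L) (h : Dist x L) :
    len (x * sp n L) = len x + (L.filter (fun l => l.2.1)).length := by
  induction L generalizing x with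
  | nil => simp [sp_nil]
  | cons l L ih =>
    have := ih hL.tail h.2
    rw [sp_cons, ← mul_assoc, this]
    have h1 := len_asc hL.head h.1
    unfold spL
    by_cases hc : l.2.1 = true
    · simp [hc, h1]; omega
    · simp [hc]

lemma Dist.asc_inv {l : Lt} {L : List Lt} (hL : Valid n (l :: L))
    (h : Dist (1 : Equiv.Perm (Fin n)) (l :: L)) (hl : l.2.1 = true) :
    Asc (sp n L)⁻¹ l.1 := by
  have h1 := Dist.len hL h
  have h2 := Dist.len hL.tail (Dist.tail hL.tail h)
  apply asc_of_len hL.head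
  have e : (sp n L)⁻¹ * sperm n l.1 = (sp n (l :: L))⁻¹ := by
    rw [sp_cons, spL, if_pos hl, _root_.mul_inv_rev, sperm_inv]
  rw [e, len_inv, len_inv]
  simp [hl, len_one] at h1 h2
  omega

lemma len_sp_le {L : List Lt} (hL : Valid n L) : len (sp n (ws L)) ≤ L.length := by
  induction L with
  | nil => simp [ws, sp_nil, len_one]
  | cons l L ih =>
    rw [ws_cons, sp_cons]
    have h1 := len_subadd (spL n (wL l)) (sp n (ws L))
    have h2 := ih hL.tail
    have h3 : len (spL n (wL l)) = 1 := by simpa [spL, wL] using len_sperm hL.head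
    simp
    omega

lemma dist_of_reduced {x : Equiv.Perm (Fin n)} {L : List Lt} (hL : Valid n L)
    (h : len (x * sp n (ws L)) = len x + L.length) : Dist x (ws L) := by
  induction L generalizing x with
  | nil => trivial
  | cons l L ih =>
    have h1 := len_sp_le hL.tail
    rw [ws_cons, sp_cons, ← mul_assoc] at h
    have h2 := len_subadd (x * spL n (wL l)) (sp n (ws L))
    have e : spL n (wL l) = sperm n l.1 := by simp [spL, wL]
    simp only [List.length_cons] at h
    rw [e] at h h2
    have ha : Asc x l.1 := asc_of_len hL.head (by omega)
    have h3 := len_asc hL.head ha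
    refine ⟨ha, ?_⟩
    rw [e]
    exact ih hL.tail (by omega)
/-! ### Triangular matrices -/

abbrev Mat (n : ℕ) := Matrix (Fin n) (Fin n) ℝ

def LT (g : Mat n) : Prop := ∀ i j : Fin n, i < j → g i j = 0
def UT (g : Mat n) : Prop := ∀ i j : Fin n, j < i → g i j = 0

lemma lt_iff (g : Mat n) : LT g ↔ g.BlockTriangular OrderDual.toDual := by
  constructor
  · intro h i j hij; exact h i j hij
  · intro h i j hij; exact h hij

lemma LT.mul {g h : Mat n} (hg : LT g) (hh : LT h) : LT (g * h) := by
  rw [lt_iff] at *; exact Matrix.BlockTriangular.mul hg hh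

lemma LT.inv {g : Mat n} (hg : LT g) (hd : g.det = 1) : LT g⁻¹ := by
  rw [lt_iff] at *
  have : Invertible g := Matrix.invertibleOfIsUnitDet g (by rw [hd]; exact isUnit_one)
  exact Matrix.blockTriangular_inv_of_blockTriangular hg

lemma LT.det {g : Mat n} (hg : LT g) : g.det = ∏ i, g i i :=
  Matrix.det_of_isLowerTriangular g ((lt_iff g).1 hg)

lemma UT.tr {g : Mat n} (hg : UT g) : LT gᵀ := fun i j h => hg j i h
lemma LT.tr {g : Mat n} (hg : LT g) : UT gᵀ := fun i j h => hg j i h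
lemma ut_iff (g : Mat n) : UT g ↔ LT gᵀ := ⟨UT.tr, fun h i j hij => h j i hij⟩

lemma UT.mul {g h : Mat n} (hg : UT g) (hh : UT h) : UT (g * h) := by
  rw [ut_iff, Matrix.transpose_mul]; exact hh.tr.mul hg.tr

lemma UT.inv {g : Mat n} (hg : UT g) (hd : g.det = 1) : UT g⁻¹ := by
  rw [ut_iff, Matrix.transpose_nonsing_inv]; exact hg.tr.inv (by rwa [Matrix.det_transpose])

lemma UT.det {g : Mat n} (hg : UT g) : g.det = ∏ i, g i i := by
  rw [← Matrix.det_transpose, hg.tr.det]; rfl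

lemma LT.one : LT (1 : Mat n) := fun i j h => Matrix.one_apply_ne h.ne
lemma UT.one : UT (1 : Mat n) := fun i j h => Matrix.one_apply_ne h.ne'

lemma LT.mul_diag {g h : Mat n} (hg : LT g) (hh : LT h) (i : Fin n) :
    (g * h) i i = g i i * h i i := by
  rw [Matrix.mul_apply]
  apply Finset.sum_eq_single_of_mem _ (Finset.mem_univ _)
  intro j _ hj
  rcases lt_or_gt_of_ne hj with h1 | h1
  · rw [hh _ _ h1, mul_zero]
  · rw [hg _ _ h1, zero_mul]

lemma UT.mul_diag {g h : Mat n} (hg : UT g) (hh : UT h) (i : Fin n) :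
    (g * h) i i = g i i * h i i := by
  have := LT.mul_diag hh.tr hg.tr i
  rw [← Matrix.transpose_mul] at this
  simpa [mul_comm] using this

lemma isN_one : IsN (1 : Mat n) := ⟨fun i => by simp, UT.one⟩

lemma IsN.mul {g h : Mat n} (hg : IsN g) (hh : IsN h) : IsN (g * h) :=
  ⟨fun i => by rw [UT.mul_diag hg.2 hh.2, hg.1, hh.1, one_mul], UT.mul hg.2 hh.2⟩

lemma IsN.det {g : Mat n} (hg : IsN g) : g.det = 1 := by
  rw [UT.det hg.2]; simp [hg.1]

lemma mul_inv_of_det {g : Mat n} (h : g.det = 1) : g * g⁻¹ = 1 :=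
  Matrix.mul_nonsing_inv g (by rw [h]; exact isUnit_one)

lemma inv_mul_of_det {g : Mat n} (h : g.det = 1) : g⁻¹ * g = 1 :=
  Matrix.nonsing_inv_mul g (by rw [h]; exact isUnit_one)

lemma det_inv_one {g : Mat n} (h : g.det = 1) : g⁻¹.det = 1 := by
  simp [Matrix.det_nonsing_inv, h]

lemma IsN.inv {g : Mat n} (hg : IsN g) : IsN g⁻¹ := by
  have hu := UT.inv hg.2 hg.det
  refine ⟨fun i => ?_, hu⟩
  have := UT.mul_diag hg.2 hu i
  rw [mul_inv_of_det hg.det, hg.1] at this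
  simpa using this.symm

lemma IsN.tr {g : Mat n} (hg : IsN g) : IsNm gᵀ := ⟨hg.1, fun i j h => hg.2 j i h⟩
lemma IsNm.tr {g : Mat n} (hg : IsNm g) : IsN gᵀ := ⟨hg.1, fun i j h => hg.2 j i h⟩

/-! ### Signed permutation matrices -/

def SPe (x : Equiv.Perm (Fin n)) (ε : Fin n → ℝ) (M : Mat n) : Prop :=
  (∀ b, ε b * ε b = 1) ∧ ∀ a b, M a b = if a = x b then ε b else 0

def SP (x : Equiv.Perm (Fin n)) (M : Mat n) : Prop := ∃ ε, SPe x ε M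

lemma SPe.mul_tr {x : Equiv.Perm (Fin n)} {ε : Fin n → ℝ} {M : Mat n} (h : SPe x ε M) :
    Mᵀ * M = 1 := by
  ext p q
  rw [Matrix.mul_apply]
  simp only [Matrix.transpose_apply, h.2]
  simp only [ite_mul, zero_mul, Finset.sum_ite_eq', Finset.sum_ite_eq, Finset.mem_univ, if_true]
  by_cases e : p = q
  · subst e; simp [h.1]
  · simp [e]

lemma SP.tr_mul {x : Equiv.Perm (Fin n)} {M : Mat n} (h : SP x M) : Mᵀ * M = 1 := by
  obtain ⟨ε, h⟩ := h; exact h.mul_tr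

lemma SP.mul_tr {x : Equiv.Perm (Fin n)} {M : Mat n} (h : SP x M) : M * Mᵀ = 1 :=
  mul_eq_one_comm.1 h.tr_mul

lemma SP.mul {x y : Equiv.Perm (Fin n)} {M N : Mat n} (h : SP x M) (h' : SP y N) :
    SP (x * y) (M * N) := by
  obtain ⟨ε, h⟩ := h
  obtain ⟨δ, h'⟩ := h'
  refine ⟨fun b => ε (y b) * δ b, fun b => ?_, fun a b => ?_⟩
  · have h1 := h.1 (y b)
    have h2 := h'.1 b
    calc _ = (ε (y b) * ε (y b)) * (δ b * δ b) := by ring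
      _ = 1 := by rw [h1, h2, one_mul]
  · rw [Matrix.mul_apply]
    simp only [h.2, h'.2, mul_ite, mul_zero, Finset.sum_ite_eq', Finset.sum_ite_eq,
      Finset.mem_univ, if_true, ite_mul, zero_mul, Equiv.Perm.mul_apply]
    congr

lemma SP.one : SP (1 : Equiv.Perm (Fin n)) (1 : Mat n) :=
  ⟨fun _ => 1, by simp, fun a b => by rw [Matrix.one_apply]; simp only [Equiv.Perm.one_apply]; congr⟩

lemma SPe.mul_right {x : Equiv.Perm (Fin n)} {ε : Fin n → ℝ} {M : Mat n} (h : SPe x ε M)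
    (X : Mat n) (p q : Fin n) : (X * M) p q = X p (x q) * ε q := by
  rw [Matrix.mul_apply]
  simp [h.2]

lemma SPe.tr_mul_left {x : Equiv.Perm (Fin n)} {ε : Fin n → ℝ} {M : Mat n} (h : SPe x ε M)
    (X : Mat n) (p q : Fin n) : (Mᵀ * X) p q = ε p * X (x p) q := by
  rw [Matrix.mul_apply]
  simp [h.2]

lemma SPe.mul_left {x : Equiv.Perm (Fin n)} {ε : Fin n → ℝ} {M : Mat n} (h : SPe x ε M)
    (X : Mat n) (p q : Fin n) : (M * X) (x p) q = ε p * X p q := by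
  rw [Matrix.mul_apply]
  simp [h.2]

lemma SPe.mul_right_tr {x : Equiv.Perm (Fin n)} {ε : Fin n → ℝ} {M : Mat n} (h : SPe x ε M)
    (X : Mat n) (p q : Fin n) : (X * Mᵀ) p (x q) = X p q * ε q := by
  rw [Matrix.mul_apply]
  simp [h.2]

lemma SPe.conj {x : Equiv.Perm (Fin n)} {ε : Fin n → ℝ} {M : Mat n} (h : SPe x ε M)
    (X : Mat n) (p q : Fin n) : (M * X * Mᵀ) (x p) (x q) = ε p * X p q * ε q := by
  rw [h.mul_right_tr, h.mul_left]

lemma SPe.tr_conj {x : Equiv.Perm (Fin n)} {ε : Fin n → ℝ} {M : Mat n} (h : SPe x ε M)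
    (X : Mat n) (p q : Fin n) : (Mᵀ * X * M) p q = ε p * X (x p) (x q) * ε q := by
  rw [h.mul_right, h.tr_mul_left]

lemma SPe.det {x : Equiv.Perm (Fin n)} {ε : Fin n → ℝ} {M : Mat n} (h : SPe x ε M) :
    M.det = (∏ b, ε b) * (Equiv.Perm.sign x : ℤ) := by
  have : M = Matrix.of fun a b => ε b * ((1 : Mat n).submatrix id x) a b := by
    ext a b
    simp [h.2, Matrix.one_apply]
  rw [this, Matrix.det_mul_row, Matrix.det_permute']
  simp

/-- sign vector of `sdot` -/
def eps (a : Fin n) : Fin n → ℝ := fun c => if c = a then -1 else 1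

lemma spe_sdot {a b : Fin n} (hab : (a : ℕ) + 1 = b) :
    SPe (Equiv.swap a b) (eps a) (sdot (b : ℕ) : Mat n) := by
  refine ⟨fun c => by unfold eps; split_ifs <;> norm_num, fun p q => ?_⟩
  unfold sdot eps
  simp only [Matrix.of_apply, Equiv.swap_apply_def]
  simp only [Fin.ext_iff]
  split_ifs <;> first | rfl | omega

lemma sp_sdot {i : ℕ} (hi : 1 ≤ i ∧ i < n) : SP (sperm n i) (sdot i : Mat n) := by
  obtain ⟨a, b, hab, rfl⟩ := exists_ab hi
  rw [sperm_eq hab]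
  exact ⟨_, spe_sdot hab⟩

lemma det_sdot {i : ℕ} (hi : 1 ≤ i ∧ i < n) : (sdot i : Mat n).det = 1 := by
  obtain ⟨a, b, hab, rfl⟩ := exists_ab hi
  rw [(spe_sdot hab).det]
  have hne : a ≠ b := by intro h; rw [h] at hab; omega
  rw [Equiv.Perm.sign_swap hne]
  simp [eps, Finset.prod_ite_eq']

lemma sp_sdL {l : Lt} (hi : 1 ≤ l.1 ∧ l.1 < n) : SP (spL n l) (sdL n l) := by
  unfold spL sdL
  split_ifs
  · exact sp_sdot hi
  · exact SP.one

lemma sp_sd {L : List Lt} (hL : Valid n L) : SP (sp n L) (sd n L) := by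
  induction L with
  | nil => exact SP.one
  | cons l L ih => rw [sp_cons, sd_cons]; exact (sp_sdL hL.head).mul (ih hL.tail)

lemma det_sd {L : List Lt} (hL : Valid n L) : (sd n L).det = 1 := by
  induction L with
  | nil => simp [sd_nil]
  | cons l L ih =>
    rw [sd_cons, Matrix.det_mul, ih hL.tail, mul_one]
    unfold sdL
    split_ifs
    · exact det_sdot hL.head
    · simp

lemma xmat_apply {a b : Fin n} (hab : (a : ℕ) + 1 = b) (t : ℝ) (p q : Fin n) :
    (xmat (b : ℕ) t : Mat n) p q = if p = q then 1 else if p = a ∧ q = b then t else 0 := by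
  unfold xmat
  simp only [Matrix.of_apply, Fin.ext_iff]
  have : ((p : ℕ) + 1 = b ∧ (q : ℕ) = b) ↔ ((p : ℕ) = a ∧ (q : ℕ) = b) := by omega
  simp only [this]

lemma ymat_apply {a b : Fin n} (hab : (a : ℕ) + 1 = b) (t : ℝ) (p q : Fin n) :
    (ymat (b : ℕ) t : Mat n) p q = if p = q then 1 else if p = b ∧ q = a then t else 0 := by
  unfold ymat
  simp only [Matrix.of_apply, Fin.ext_iff]
  have : ((p : ℕ) = b ∧ (q : ℕ) + 1 = b) ↔ ((p : ℕ) = b ∧ (q : ℕ) = a) := by omega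
  simp only [this]

lemma isN_xmat {i : ℕ} (hi : 1 ≤ i ∧ i < n) (t : ℝ) : IsN (xmat i t : Mat n) := by
  obtain ⟨a, b, hab, rfl⟩ := exists_ab hi
  refine ⟨fun p => by simp [xmat_apply hab], fun p q h => ?_⟩
  rw [xmat_apply hab, if_neg h.ne', if_neg]
  rintro ⟨rfl, rfl⟩
  rw [Fin.lt_def] at h; omega

lemma lt_ymat {i : ℕ} (hi : 1 ≤ i ∧ i < n) (t : ℝ) : LT (ymat i t : Mat n) := by
  obtain ⟨a, b, hab, rfl⟩ := exists_ab hi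
  intro p q h
  rw [ymat_apply hab, if_neg h.ne, if_neg]
  rintro ⟨rfl, rfl⟩
  rw [Fin.lt_def] at h; omega

lemma det_ymat {i : ℕ} (hi : 1 ≤ i ∧ i < n) (t : ℝ) : (ymat i t : Mat n).det = 1 := by
  rw [(lt_ymat hi t).det]
  simp [ymat]

lemma det_gL {l : Lt} (hi : 1 ≤ l.1 ∧ l.1 < n) : (gL n l).det = 1 := by
  unfold gL
  split_ifs
  · exact det_sdot hi
  · exact (isN_xmat hi _).det

lemma det_gg {L : List Lt} (hL : Valid n L) : (gg n L).det = 1 := by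
  induction L with
  | nil => simp [gg_nil]
  | cons l L ih => rw [gg_cons, Matrix.det_mul, ih hL.tail, det_gL hL.head, mul_one]

lemma ymat_mul {a b : Fin n} (hab : (a : ℕ) + 1 = b) (t : ℝ) (X : Mat n) (p q : Fin n) :
    ((ymat (b : ℕ) t : Mat n) * X) p q = X p q + if p = b then t * X a q else 0 := by
  have hne : a ≠ b := by intro h; rw [h] at hab; omega
  have : (ymat (b : ℕ) t : Mat n) = 1 + Matrix.single b a t := by
    ext p q
    rw [ymat_apply hab, Matrix.add_apply, Matrix.one_apply, Matrix.single_apply]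
    by_cases h : p = q
    · subst h
      have : ¬ (b = p ∧ a = p) := by rintro ⟨rfl, h⟩; exact hne h
      simp [this]
    · simp [h, eq_comm]
  rw [this, Matrix.add_mul, one_mul, Matrix.add_apply]
  by_cases h : p = b
  · subst h; simp
  · simp [h]

lemma mul_xmat {a b : Fin n} (hab : (a : ℕ) + 1 = b) (t : ℝ) (X : Mat n) (p q : Fin n) :
    (X * (xmat (b : ℕ) t : Mat n)) p q = X p q + if q = b then X p a * t else 0 := by
  have hne : a ≠ b := by intro h; rw [h] at hab; omega
  have : (xmat (b : ℕ) t : Mat n) = 1 + Matrix.single a b t := by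
    ext p q
    rw [xmat_apply hab, Matrix.add_apply, Matrix.one_apply, Matrix.single_apply]
    by_cases h : p = q
    · subst h
      have : ¬ (a = p ∧ b = p) := by rintro ⟨h, rfl⟩; exact hne h
      simp [this]
    · simp [h, eq_comm]
  rw [this, Matrix.mul_add, mul_one, Matrix.add_apply]
  by_cases h : q = b
  · subst h; simp
  · simp [h]

/-! ### Unipotent factorization of `gg` -/

lemma isN_conj {x : Equiv.Perm (Fin n)} {M : Mat n} (h : SP x M) {i : ℕ} (hi : 1 ≤ i ∧ i < n)
    (ha : Asc x i) (t : ℝ) : IsN (M * xmat i t * Mᵀ) := by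
  obtain ⟨a, b, hab, rfl⟩ := exists_ab hi
  rw [asc_iff x hab] at ha
  obtain ⟨ε, h⟩ := h
  refine ⟨fun p => ?_, fun p q hpq => ?_⟩
  · obtain ⟨p, rfl⟩ := x.surjective p
    rw [h.conj, xmat_apply hab, if_pos rfl, mul_one, h.1]
  · obtain ⟨p, rfl⟩ := x.surjective p
    obtain ⟨q, rfl⟩ := x.surjective q
    rw [h.conj, xmat_apply hab, if_neg (by rintro rfl; exact lt_irrefl _ hpq), if_neg, mul_zero,
      zero_mul]
    rintro ⟨rfl, rfl⟩
    exact lt_asymm ha hpq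

lemma gg_unip {x : Equiv.Perm (Fin n)} {M : Mat n} (h : SP x M) {L : List Lt} (hL : Valid n L)
    (hd : Dist x L) : ∃ u, IsN u ∧ M * gg n L = u * (M * sd n L) := by
  induction L generalizing x M with
  | nil => exact ⟨1, isN_one, by simp [gg_nil, sd_nil]⟩
  | cons l L ih =>
    by_cases hc : l.2.1 = true
    · have h2 := hd.2
      obtain ⟨u, hu, e⟩ := ih (h.mul (sp_sdL hL.head)) hL.tail h2
      refine ⟨u, hu, ?_⟩
      rw [gg_cons, sd_cons, ← mul_assoc, ← mul_assoc M, ← e]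
      simp [gL, sdL, hc]
    · have h2 := hd.2
      have e1 : spL n l = 1 := by simp [spL, hc]
      rw [e1, mul_one] at h2
      obtain ⟨u, hu, e⟩ := ih h hL.tail h2
      refine ⟨(M * xmat l.1 l.2.2 * Mᵀ) * u, (isN_conj h hL.head hd.1 _).mul hu, ?_⟩
      rw [gg_cons, sd_cons]
      have e2 : sdL n l = 1 := by simp [sdL, hc]
      have e3 : gL n l = xmat l.1 l.2.2 := by simp [gL, hc]
      rw [e2, e3, one_mul, mul_assoc _ u, ← e, mul_assoc _ Mᵀ, ← mul_assoc Mᵀ, h.tr_mul, one_mul,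
        mul_assoc]

lemma gg_unip' {L : List Lt} (hL : Valid n L) (hd : Dist (1 : Equiv.Perm (Fin n)) L) :
    ∃ u, IsN u ∧ gg n L = u * sd n L := by
  simpa using gg_unip SP.one hL hd

/-! ### The factorization -/

lemma step_lt {a b : Fin n} (hab : (a : ℕ) + 1 = b) {M : Mat n}
    (h0 : ∀ p q : Fin n, p < q → ¬ (p = a ∧ q = b) → M p q = 0) (h1 : M a b ≠ 0) :
    LT ((sdot (b : ℕ) : Mat n)ᵀ * ((ymat (b : ℕ) (-(M b b / M a b)) : Mat n) * M)) := by
  have hlt : a < b := by rw [Fin.lt_def]; omega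
  intro p q hpq
  rw [(spe_sdot hab).tr_mul_left, ymat_mul hab]
  by_cases hpa : p = a
  · subst hpa
    rw [Equiv.swap_apply_left, if_pos rfl]
    by_cases hqb : q = b
    · subst hqb
      field_simp
      ring
    · have : b < q := by
        rw [Fin.lt_def] at *; rw [Fin.ext_iff] at hqb; omega
      rw [h0 b q this (by rintro ⟨rfl, -⟩; exact hlt.ne rfl), h0 p q hpq (by tauto)]
      simp
  · by_cases hpb : p = b
    · subst hpb
      rw [Equiv.swap_apply_right, if_neg hlt.ne, h0 a q (hlt.trans hpq)]
      · simp
      · rintro ⟨-, rfl⟩; exact lt_irrefl _ hpq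
    · rw [Equiv.swap_apply_of_ne_of_ne hpa hpb, if_neg hpb, h0 p q hpq (by tauto)]
      simp

lemma ymat_neg {i : ℕ} (hi : 1 ≤ i ∧ i < n) (t : ℝ) :
    (ymat i t : Mat n) * (ymat i (-t) : Mat n) = 1 := by
  obtain ⟨a, b, hab, rfl⟩ := exists_ab hi
  have hne : a ≠ b := by intro h; rw [h] at hab; omega
  ext p q
  rw [ymat_mul hab, ymat_apply hab, ymat_apply hab, Matrix.one_apply]
  by_cases h1 : p = q
  · subst h1
    by_cases h2 : p = b
    · subst h2; simp [hne]
    · simp [h2]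
  · by_cases h2 : p = b
    · subst h2
      by_cases h3 : a = q
      · subst h3; simp [h1]
      · simp [h1, h3, Ne.symm h3]
    · simp [h1, h2]

lemma LT.diag_ne {c : Mat n} (hc : LT c) (hd : c.det = 1) (p : Fin n) : c p p ≠ 0 := by
  intro h
  rw [hc.det] at hd
  have := Finset.prod_eq_zero (f := fun i => c i i) (Finset.mem_univ p) h
  exact zero_ne_one (this.symm.trans hd)

lemma step {c : Mat n} (hc : LT c) (hd : c.det = 1) {l : Lt} (hi : 1 ≤ l.1 ∧ l.1 < n)
    (ht : l.2.1 = false → l.2.2 ≠ 0) :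
    ∃ τ c1, LT c1 ∧ c1.det = 1 ∧ c * gL n l = ymat l.1 τ * (sdot l.1 * c1) := by
  obtain ⟨i, e, t⟩ := l
  obtain ⟨a, b, hab, hb⟩ := exists_ab hi
  simp only at hb hi ht
  subst hb
  have hlt : a < b := by rw [Fin.lt_def]; omega
  set M := c * gL n ((b : ℕ), e, t) with hM
  have h0 : ∀ p q : Fin n, p < q → ¬ (p = a ∧ q = b) → M p q = 0 := by
    intro p q hpq hne
    rw [hM]
    cases e with
    | true =>
      simp only [gL, if_true]
      rw [(spe_sdot hab).mul_right]
      rw [hc, zero_mul]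
      simp only [Equiv.swap_apply_def]
      simp only [Fin.ext_iff, Fin.lt_def] at *
      split_ifs <;> omega
    | false =>
      simp only [gL]
      simp only [Bool.false_eq_true, if_false]
      rw [mul_xmat hab, hc p q hpq]
      by_cases hq : q = b
      · rw [if_pos hq, hc p a, zero_mul, zero_add]
        simp only [Fin.ext_iff, Fin.lt_def] at *
        omega
      · simp [hq]
  have h1 : M a b ≠ 0 := by
    rw [hM]
    cases e with
    | true =>
      simp only [gL, if_true]
      rw [(spe_sdot hab).mul_right, Equiv.swap_apply_right]
      simp [eps, hlt.ne', hc.diag_ne hd]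
    | false =>
      simp only [gL]
      simp only [Bool.false_eq_true, if_false]
      rw [mul_xmat hab, hc a b hlt]
      simp [hc.diag_ne hd, ht rfl]
  have hs : SP (sperm n b) (sdot (b : ℕ) : Mat n) := sp_sdot hi
  refine ⟨M b b / M a b, _, step_lt hab h0 h1, ?_, ?_⟩
  · rw [Matrix.det_mul, Matrix.det_mul, Matrix.det_transpose, det_sdot hi, det_ymat hi, hM,
      Matrix.det_mul, hd, det_gL hi]
    norm_num
  · rw [← mul_assoc (sdot _), hs.mul_tr, one_mul, ← mul_assoc, ymat_neg hi, one_mul]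

lemma sd_ws_cons (l : Lt) (L : List Lt) : sd n (ws (l :: L)) = sdot l.1 * sd n (ws L) := by
  rw [ws_cons, sd_cons]; simp [sdL, wL]

lemma sp_ws_cons (l : Lt) (L : List Lt) : sp n (ws (l :: L)) = sperm n l.1 * sp n (ws L) := by
  rw [ws_cons, sp_cons]; simp [spL, wL]

lemma factor {L : List Lt} (hL : Valid n L) (hd : Dist (1 : Equiv.Perm (Fin n)) (ws L))
    (ht : ∀ l ∈ L, l.2.1 = false → l.2.2 ≠ 0) {c : Mat n} (hc : LT c) (hcd : c.det = 1) :
    ∃ c', LT c' ∧ c'.det = 1 ∧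
      (∀ L1 L2, L = L1 ++ L2 → ∃ D, LT D ∧ gg n L2 = D * (sd n (ws L2) * c')) ∧
      ∃ U, UT U ∧ c * gg n L = sd n (ws L) * (U * c') := by
  induction L generalizing c with
  | nil =>
    refine ⟨c, hc, hcd, ?_, 1, UT.one, by simp [gg_nil, ws, sd_nil]⟩
    intro L1 L2 h
    have : L2 = [] := by
      exact (List.append_eq_nil_iff.1 h.symm).2
    subst this
    exact ⟨c⁻¹, hc.inv hcd, by simp [gg_nil, ws, sd_nil, inv_mul_of_det hcd]⟩
  | cons l L ih =>
    have hi := hL.head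
    have hs : SP (sperm n l.1) (sdot l.1 : Mat n) := sp_sdot hi
    obtain ⟨τ, c1, hc1, hc1d, e1⟩ := step hc hcd hi (ht l List.mem_cons_self)
    obtain ⟨c', hc', hc'd, hsuf, U, hU, e2⟩ := ih hL.tail (Dist.tail hL.tail.ws hd)
      (fun l hl => ht l (List.mem_cons_of_mem _ hl)) hc1 hc1d
    obtain ⟨D1, hD1, e3⟩ := hsuf [] L rfl
    have hW : SP (sp n (ws L)) (sd n (ws L)) := sp_sd hL.tail.ws
    have hasc : Asc (sp n (ws L))⁻¹ l.1 := Dist.asc_inv (l := wL l) hL.ws hd rfl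
    have hasc' : ∀ a b : Fin n, (a : ℕ) + 1 = b → (b : ℕ) = l.1 → ∀ p q,
        sp n (ws L) p = b → sp n (ws L) q = a → q < p := by
      intro a b hab hb p q hp hq
      have := hasc a b hab hb
      rw [← hp, ← hq] at this
      simpa using this
    -- E
    have hEE : sd n (ws L) * U * (sd n (ws L))ᵀ = c1 * D1 := by
      have : sd n (ws L) * U * c' = c1 * D1 * sd n (ws L) * c' := by
        rw [mul_assoc, ← e2, e3]; simp only [mul_assoc]
      have h2 := congrArg (· * c'⁻¹) this
      simp only [mul_assoc _ c', mul_inv_of_det hc'd, mul_one] at h2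
      rw [h2, mul_assoc, hW.mul_tr, mul_one]
    have hE : LT (sd n (ws L) * U * (sd n (ws L))ᵀ) := by rw [hEE]; exact hc1.mul hD1
    have hsE : LT ((sdot l.1 : Mat n) * (sd n (ws L) * U * (sd n (ws L))ᵀ) *
        (sdot l.1 : Mat n)ᵀ) := by
      obtain ⟨a, b, hab, hb⟩ := exists_ab hi
      intro p q hpq
      rw [← hb]
      obtain ⟨p, rfl⟩ := (Equiv.swap a b).surjective p
      obtain ⟨q, rfl⟩ := (Equiv.swap a b).surjective q
      rw [(spe_sdot hab).conj]
      rcases lt_trichotomy p q with h | h | h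
      · rw [hE _ _ h]; simp
      · subst h; exact absurd hpq (lt_irrefl _)
      · by_cases hc : q = a ∧ p = b
        · obtain ⟨rfl, rfl⟩ := hc
          obtain ⟨ε, hε⟩ := hW
          obtain ⟨p', hp'⟩ := (sp n (ws L)).surjective p
          obtain ⟨q', hq'⟩ := (sp n (ws L)).surjective q
          have := hasc' q p hab hb p' q' hp' hq'
          rw [← hp', ← hq', hε.conj, hU _ _ this]
          simp
        · exact absurd (swap_lt hab h hc) (lt_asymm hpq)
    have key : c * gg n (l :: L) = ymat l.1 τ * (sdot l.1 * (sd n (ws L) * (U * c'))) := by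
      rw [gg_cons, ← mul_assoc, e1, mul_assoc, mul_assoc, e2]
    refine ⟨c', hc', hc'd, ?_, (sd n (ws (l :: L)))ᵀ * ymat l.1 τ * sd n (ws (l :: L)) * U, ?_, ?_⟩
    · intro L1 L2 h
      cases L1 with
      | nil =>
        simp only [List.nil_append] at h
        subst h
        refine ⟨c⁻¹ * (ymat l.1 τ * ((sdot l.1 : Mat n) * (sd n (ws L) * U * (sd n (ws L))ᵀ) *
          (sdot l.1 : Mat n)ᵀ)), (hc.inv hcd).mul ((lt_ymat hi τ).mul hsE), ?_⟩
        have : gg n (l :: L) = c⁻¹ * (c * gg n (l :: L)) := by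
          rw [← mul_assoc, inv_mul_of_det hcd, one_mul]
        rw [this, key, sd_ws_cons]
        simp only [mul_assoc]
        congr 4
        rw [← mul_assoc (sdot l.1)ᵀ, hs.tr_mul, one_mul, ← mul_assoc (sd n (ws L))ᵀ, hW.tr_mul,
          one_mul]
      | cons l' L1 =>
        simp only [List.cons_append, List.cons.injEq] at h
        exact hsuf L1 L2 h.2
    · refine UT.mul ?_ hU
      obtain ⟨a, b, hab, hb⟩ := exists_ab hi
      obtain ⟨ε, hε⟩ := sp_sd (n := n) hL.ws
      intro p q hpq
      rw [hε.tr_conj, ← hb, ymat_apply hab, if_neg, if_neg]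
      · simp
      · rintro ⟨h1, h2⟩
        rw [sp_ws_cons, ← hb, sperm_eq hab, Equiv.Perm.mul_apply] at h1 h2
        have h1' : sp n (ws L) p = a := by simpa using congrArg (Equiv.swap a b) h1
        have h2' : sp n (ws L) q = b := by simpa using congrArg (Equiv.swap a b) h2
        exact lt_asymm hpq (hasc' a b hab hb q p h2' h1')
      · intro h
        exact hpq.ne' (Equiv.injective _ h)
    · rw [key, sd_ws_cons]
      have h := (hs.mul hW).mul_tr
      generalize (sdot l.1 : Mat n) = S at *
      generalize sd n (ws L) = W at *
      calc ymat l.1 τ * (S * (W * (U * c'))) = 1 * (ymat l.1 τ * (S * (W * (U * c')))) := by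
            rw [one_mul]
        _ = _ := by rw [← h]; simp only [mul_assoc]
/-! ### Minors -/

lemma minor_eq (g : Mat n) {I J : Finset (Fin n)} {k : ℕ} (hI : I.card = k) (hJ : J.card = k) :
    minor g I J = (g.submatrix (I.orderEmbOfFin hI) (J.orderEmbOfFin hJ)).det := by
  subst hI
  unfold minor
  rw [dif_pos hJ.symm]
  rfl

lemma minor_ne (g : Mat n) {I J : Finset (Fin n)} (h : I.card ≠ J.card) : minor g I J = 0 := by
  unfold minor
  rw [dif_neg h]

lemma minor_tr (g : Mat n) (I J : Finset (Fin n)) : minor gᵀ I J = minor g J I := by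
  by_cases h : I.card = J.card
  · rw [minor_eq gᵀ h rfl, minor_eq g rfl h, ← Matrix.det_transpose]
    rfl
  · rw [minor_ne _ h, minor_ne _ (Ne.symm h)]

lemma sum_emb (J : Finset (Fin n)) {k : ℕ} (hJ : J.card = k) (f : Fin n → ℝ) :
    ∑ q, f (J.orderEmbOfFin hJ q) = ∑ j ∈ J, f j := by
  conv_rhs => rw [← Finset.map_orderEmbOfFin_univ J hJ, Finset.sum_map]
  rfl

lemma prod_emb (J : Finset (Fin n)) {k : ℕ} (hJ : J.card = k) (f : Fin n → ℝ) :
    ∏ q, f (J.orderEmbOfFin hJ q) = ∏ j ∈ J, f j := by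
  conv_rhs => rw [← Finset.map_orderEmbOfFin_univ J hJ, Finset.prod_map]
  rfl

lemma minor_mul (X b : Mat n) (R J : Finset (Fin n))
    (hb : ∀ k j, j ∈ J → k ∉ J → b k j = 0) :
    minor (X * b) R J = minor X R J * minor b J J := by
  by_cases h : R.card = J.card
  · rw [minor_eq (X * b) h rfl, minor_eq X h rfl, minor_eq b rfl rfl, ← Matrix.det_mul]
    congr 1
    ext p q
    rw [Matrix.submatrix_apply, Matrix.mul_apply, Matrix.mul_apply]
    simp only [Matrix.submatrix_apply]
    rw [sum_emb J rfl (fun k => X (R.orderEmbOfFin h p) k * b k (J.orderEmbOfFin rfl q))]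
    symm
    apply Finset.sum_subset (Finset.subset_univ _)
    intro k _ hk
    rw [hb k _ (Finset.orderEmbOfFin_mem J rfl q) hk, mul_zero]
  · rw [minor_ne _ h, minor_ne _ h, zero_mul]

lemma minor_lt {b : Mat n} (hb : LT b) (J : Finset (Fin n)) : minor b J J = ∏ j ∈ J, b j j := by
  rw [minor_eq b rfl rfl, LT.det, ← prod_emb J rfl]
  · rfl
  · intro p q h
    exact hb _ _ ((J.orderEmbOfFin rfl).strictMono h)

lemma minor_ut {b : Mat n} (hb : UT b) (J : Finset (Fin n)) : minor b J J = ∏ j ∈ J, b j j := by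
  rw [← minor_tr, minor_lt hb.tr]; rfl

lemma minor_isN {b : Mat n} (hb : IsN b) (J : Finset (Fin n)) : minor b J J = 1 := by
  rw [minor_ut hb.2]; simp [hb.1]

lemma swap_mem_image {a b : Fin n} {J : Finset (Fin n)} (h : a ∈ J ↔ b ∈ J) :
    J.image (Equiv.swap a b) = J := by
  ext x
  simp only [Finset.mem_image]
  constructor
  · rintro ⟨y, hy, rfl⟩
    rw [Equiv.swap_apply_def]
    split_ifs with h1 h2
    · subst h1; exact h.1 hy
    · subst h2; exact h.2 hy
    · exact hy
  · intro hx
    refine ⟨Equiv.swap a b x, ?_, by simp⟩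
    rw [Equiv.swap_apply_def]
    split_ifs with h1 h2
    · subst h1; exact h.1 hx
    · subst h2; exact h.2 hx
    · exact hx

lemma minor_swap {a b : Fin n} (hab : (a : ℕ) + 1 = b) {c d : Fin n}
    (hcd : (c = a ∧ d = b) ∨ (c = b ∧ d = a)) {M : Mat n}
    (hM : SPe (Equiv.swap a b) (eps c) M) (X : Mat n) (R J : Finset (Fin n))
    (hJ : c ∈ J → d ∈ J) :
    minor (X * M) R J = minor X R (J.image (Equiv.swap a b)) := by
  have hne : a ≠ b := by intro h; rw [h] at hab; omega
  have hcard : (J.image (Equiv.swap a b)).card = J.card :=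
    Finset.card_image_of_injective _ (Equiv.injective _)
  by_cases h : R.card = J.card
  swap
  · rw [minor_ne _ h, minor_ne _ (by rwa [hcard])]
  rw [minor_eq (X * M) h rfl, minor_eq X h hcard]
  have e : (X * M).submatrix (R.orderEmbOfFin h) (J.orderEmbOfFin rfl) =
      Matrix.of fun p q => eps c (J.orderEmbOfFin rfl q) *
        (X.submatrix (R.orderEmbOfFin h) (Equiv.swap a b ∘ J.orderEmbOfFin rfl)) p q := by
    ext p q
    simp [hM.mul_right, mul_comm]
  rw [e, Matrix.det_mul_row, prod_emb J rfl (eps c)]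
  by_cases hc : a ∈ J ∧ b ∈ J
  · have hcJ : c ∈ J := by rcases hcd with ⟨rfl, -⟩ | ⟨rfl, -⟩; exacts [hc.1, hc.2]
    have e1 : ∏ j ∈ J, eps c j = -1 := by simp [eps, Finset.prod_ite_eq', hcJ]
    have e2 : (J.image (Equiv.swap a b)) = J := swap_mem_image (by tauto)
    obtain ⟨qa, hqa⟩ : ∃ q, J.orderEmbOfFin rfl q = a := by
      have := Finset.range_orderEmbOfFin J rfl
      rw [Set.ext_iff] at this
      exact (this a).2 hc.1
    obtain ⟨qb, hqb⟩ : ∃ q, J.orderEmbOfFin rfl q = b := by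
      have := Finset.range_orderEmbOfFin J rfl
      rw [Set.ext_iff] at this
      exact (this b).2 hc.2
    have hq : qa ≠ qb := by rintro rfl; exact hne (hqa.symm.trans hqb)
    have e3 : (Equiv.swap a b ∘ J.orderEmbOfFin rfl) = J.orderEmbOfFin rfl ∘ Equiv.swap qa qb := by
      funext q
      simp only [Function.comp]
      rw [← hqa, ← hqb, (J.orderEmbOfFin rfl).injective.swap_apply]
    have e4 : ∀ (J' : Finset (Fin n)) (hJ' : J'.card = J.card), J' = J →
        J'.orderEmbOfFin hJ' = J.orderEmbOfFin rfl := by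
      intro J' hJ' h; subst h; rfl
    rw [e1, e3, e4 _ hcard e2]
    have := Matrix.det_permute' (Equiv.swap qa qb)
      (X.submatrix (R.orderEmbOfFin h) (J.orderEmbOfFin rfl))
    rw [Matrix.submatrix_submatrix] at this
    simp only [Function.comp_id] at this
    rw [this, Equiv.Perm.sign_swap hq]
    simp
  · have hcJ : c ∉ J := by rcases hcd with ⟨rfl, rfl⟩ | ⟨rfl, rfl⟩ <;> tauto
    have e1 : ∏ j ∈ J, eps c j = 1 := by
      apply Finset.prod_eq_one
      intro j hj
      simp only [eps]
      rw [if_neg]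
      rintro rfl; exact hcJ hj
    have e2 : (Equiv.swap a b ∘ J.orderEmbOfFin rfl) =
        (J.image (Equiv.swap a b)).orderEmbOfFin hcard := by
      apply Finset.orderEmbOfFin_unique
      · intro q
        exact Finset.mem_image_of_mem _ (Finset.orderEmbOfFin_mem J rfl q)
      · intro p q hpq
        apply swap_lt hab ((J.orderEmbOfFin rfl).strictMono hpq)
        rintro ⟨h1, h2⟩
        exact hc ⟨h1 ▸ Finset.orderEmbOfFin_mem J rfl p, h2 ▸ Finset.orderEmbOfFin_mem J rfl q⟩
    rw [e1, e2, one_mul]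

lemma spe_sdot_tr {a b : Fin n} (hab : (a : ℕ) + 1 = b) :
    SPe (Equiv.swap a b) (eps b) (sdot (b : ℕ) : Mat n)ᵀ := by
  have hne : a ≠ b := by intro h; rw [h] at hab; omega
  refine ⟨fun c => by unfold eps; split_ifs <;> norm_num, fun p q => ?_⟩
  rw [Matrix.transpose_apply, (spe_sdot hab).2]
  by_cases h : q = Equiv.swap a b p
  · have h' : p = Equiv.swap a b q := by rw [h]; simp
    rw [if_pos h, if_pos h', h]
    unfold eps
    simp only [Equiv.swap_apply_eq_iff, Equiv.swap_apply_right]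
  · have h' : ¬ p = Equiv.swap a b q := by rintro rfl; simp at h
    rw [if_neg h, if_neg h']

def UpC (I : Finset (Fin n)) : Prop := ∀ p q, p < q → p ∈ I → q ∈ I
def DnC (I : Finset (Fin n)) : Prop := ∀ p q, p < q → q ∈ I → p ∈ I

lemma mem_image_perm (x : Equiv.Perm (Fin n)) (I : Finset (Fin n)) (p : Fin n) :
    p ∈ I.image x ↔ x⁻¹ p ∈ I := by
  rw [Finset.mem_image]
  constructor
  · rintro ⟨q, hq, rfl⟩; simpa using hq
  · intro h; exact ⟨_, h, by simp⟩

lemma image_mul (x y : Equiv.Perm (Fin n)) (I : Finset (Fin n)) :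
    I.image (x * y : Equiv.Perm (Fin n)) = (I.image y).image x := by
  rw [Finset.image_image]; rfl

lemma minor_sd {L : List Lt} (hL : Valid n L) (hd : Dist (1 : Equiv.Perm (Fin n)) L)
    {I : Finset (Fin n)} (hI : UpC I) (X : Mat n) (R : Finset (Fin n)) :
    minor (X * sd n L) R I = minor X R (I.image (sp n L)) := by
  induction L generalizing X with
  | nil => simp [sd_nil, sp_nil]
  | cons l L ih =>
    rw [sd_cons, ← mul_assoc, ih hL.tail (Dist.tail hL.tail hd), sp_cons, image_mul]
    by_cases hc : l.2.1 = true
    · have hasc := Dist.asc_inv hL hd hc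
      simp only [sdL, spL, hc, if_true]
      obtain ⟨a, b, hab, hb⟩ := exists_ab hL.head
      rw [← hb, sperm_eq hab]
      apply minor_swap hab (Or.inl ⟨rfl, rfl⟩) (spe_sdot hab)
      rw [mem_image_perm, mem_image_perm]
      exact hI _ _ (hasc a b hab hb)
    · simp [sdL, spL, hc]

lemma minor_sd_tr {L : List Lt} (hL : Valid n L) {x : Equiv.Perm (Fin n)} (hd : Dist x L)
    {P : Finset (Fin n)} (hP : DnC P) (X : Mat n) (R : Finset (Fin n)) :
    minor (X * (sd n L)ᵀ) R (P.image (x⁻¹ : Equiv.Perm (Fin n))) =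
      minor X R (P.image ((x * sp n L)⁻¹ : Equiv.Perm (Fin n))) := by
  induction L generalizing x with
  | nil => simp [sd_nil, sp_nil]
  | cons l L ih =>
    rw [sd_cons, sp_cons, ← mul_assoc x, ← ih hL.tail hd.2, Matrix.transpose_mul, ← mul_assoc]
    by_cases hc : l.2.1 = true
    · have hasc := hd.1
      simp only [sdL, spL, hc, if_true]
      rw [_root_.mul_inv_rev, sperm_inv, image_mul]
      obtain ⟨a, b, hab, hb⟩ := exists_ab hL.head
      rw [← hb, sperm_eq hab]
      apply minor_swap hab (Or.inr ⟨rfl, rfl⟩) (spe_sdot_tr hab)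
      rw [mem_image_perm, mem_image_perm, inv_inv]
      exact hP _ _ (hasc a b hab hb)
    · simp [sdL, spL, hc]

lemma minor_sd_tr' {L : List Lt} (hL : Valid n L) (hd : Dist (1 : Equiv.Perm (Fin n)) L)
    {P : Finset (Fin n)} (hP : DnC P) (X : Mat n) (R : Finset (Fin n)) :
    minor (X * (sd n L)ᵀ) R P = minor X R (P.image ((sp n L)⁻¹ : Equiv.Perm (Fin n))) := by
  simpa using minor_sd_tr hL hd hP X R

/-! ### Main theorem for lists -/

lemma lt_split {M : Mat n} (hM : LT M) (hd : M.det = 1) : ∃ h u, IsH h ∧ IsNm u ∧ M = h * u := by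
  have hne := hM.diag_ne hd
  refine ⟨Matrix.diagonal fun i => M i i, Matrix.of fun i j => (M i i)⁻¹ * M i j,
    ⟨?_, ?_⟩, ⟨?_, ?_⟩, ?_⟩
  · rw [Matrix.det_diagonal, ← hM.det, hd]
  · intro i j h; exact Matrix.diagonal_apply_ne _ h
  · intro i; simp [hne i]
  · intro i j h; simp [hM i j h]
  · ext i j
    simp [Matrix.diagonal_mul, hne i]

lemma IsH.lt {h : Mat n} (hh : IsH h) : LT h := fun i j hij => hh.2 i j hij.ne

lemma ud_unique {a a' M M' : Mat n} (ha : IsN a) (ha' : IsN a') (hM : LT M) (hd : M.det = 1)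
    (hM' : LT M') (h : a * M = a' * M') : a = a' := by
  have hY : a'⁻¹ * a = M' * M⁻¹ := by
    calc a'⁻¹ * a = a'⁻¹ * (a * M) * M⁻¹ := by
          rw [mul_assoc, mul_assoc a, mul_inv_of_det hd, mul_one]
      _ = M' * M⁻¹ := by rw [h, ← mul_assoc, inv_mul_of_det ha'.det, one_mul]
  have h1 : IsN (a'⁻¹ * a) := ha'.inv.mul ha
  have h2 : LT (a'⁻¹ * a) := by rw [hY]; exact hM'.mul (hM.inv hd)
  have h3 : a'⁻¹ * a = 1 := by
    ext i j
    rcases lt_trichotomy i j with h | h | h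
    · rw [h2 i j h, Matrix.one_apply_ne h.ne]
    · subst h; rw [h1.1, Matrix.one_apply_eq]
    · rw [h1.2 i j h, Matrix.one_apply_ne h.ne']
  calc a = a' * (a'⁻¹ * a) := by rw [← mul_assoc, mul_inv_of_det ha'.det, one_mul]
    _ = a' := by rw [h3, mul_one]

lemma conj_diag {x : Equiv.Perm (Fin n)} {M : Mat n} (h : SP x M) {d : Mat n} (hd : IsH d) :
    LT (M * d * Mᵀ) := by
  obtain ⟨ε, h⟩ := h
  intro p q hpq
  obtain ⟨p, rfl⟩ := x.surjective p
  obtain ⟨q, rfl⟩ := x.surjective q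
  rw [h.conj, hd.2 p q (by rintro rfl; exact lt_irrefl _ hpq)]
  simp

lemma udl_exists {L : List Lt} (hL : Valid n L) (hW : Dist (1 : Equiv.Perm (Fin n)) (ws L))
    (ht : ∀ l ∈ L, l.2.1 = false → l.2.2 ≠ 0) :
    ∃ a b c, UDL ((gg n L)ᵀ * sd n (ws L)) a b c ∧
      ∀ L1 L2, L = L1 ++ L2 → ∃ D, LT D ∧ gg n L2 = D * (sd n (ws L2) * aᵀ) := by
  obtain ⟨c', hc', hc'd, hsuf, U, hU, e⟩ := factor hL hW ht LT.one (Matrix.det_one)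
  rw [one_mul] at e
  obtain ⟨h, u, hh, hu, rfl⟩ := lt_split hc' hc'd
  have hWd := det_sd (n := n) hL.ws
  have hUd : U.det = 1 := by
    have := congrArg Matrix.det e
    rw [Matrix.det_mul, Matrix.det_mul, hc'd, det_gg hL, hWd] at this
    simpa using this.symm
  have hht : LT hᵀ := fun i j hij => hh.2 j i hij.ne'
  obtain ⟨h2, u2, hh2, hu2, e2⟩ := lt_split (hht.mul hU.tr) (by
    rw [Matrix.det_mul, Matrix.det_transpose, Matrix.det_transpose, hUd, hh.1, one_mul])
  refine ⟨uᵀ, h2, u2, ⟨hu.tr, hh2, hu2, ?_⟩, ?_⟩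
  · rw [mul_assoc, ← e2, e]
    simp only [Matrix.transpose_mul, mul_assoc]
    rw [(sp_sd (n := n) hL.ws).tr_mul, mul_one]
  · intro L1 L2 hLL
    obtain ⟨D, hD, e3⟩ := hsuf L1 L2 hLL
    have hL2 : Valid n L2 := by subst hLL; exact hL.right
    have hs := sp_sd (n := n) hL2.ws
    refine ⟨D * (sd n (ws L2) * h * (sd n (ws L2))ᵀ), hD.mul (conj_diag hs hh), ?_⟩
    rw [e3, Matrix.transpose_transpose]
    simp only [mul_assoc]
    rw [← mul_assoc (sd n (ws L2))ᵀ, hs.tr_mul, one_mul]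

lemma minor_gg {L : List Lt} (hL : Valid n L) (hd : Dist (1 : Equiv.Perm (Fin n)) L)
    {I : Finset (Fin n)} (hI : UpC I) : minor (gg n L) (I.image (sp n L)) I = 1 := by
  obtain ⟨u, hu, e⟩ := gg_unip' hL hd
  rw [e, minor_sd hL hd hI, minor_isN hu]

lemma upC_lt {I : Finset (Fin n)} (hI : UpC I) {b : Mat n} (hb : LT b) :
    ∀ k j, j ∈ I → k ∉ I → b k j = 0 := by
  intro k j hj hk
  apply hb
  by_contra hc
  rcases lt_or_eq_of_le (not_lt.1 hc) with h | h
  · exact hk (hI _ _ h hj)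
  · subst h; exact hk hj

lemma dnC_ut {I : Finset (Fin n)} (hI : DnC I) {b : Mat n} (hb : UT b) :
    ∀ k j, j ∈ I → k ∉ I → b k j = 0 := by
  intro k j hj hk
  apply hb
  by_contra hc
  rcases lt_or_eq_of_le (not_lt.1 hc) with h | h
  · exact hk (hI _ _ h hj)
  · subst h; exact hk hj

lemma main_list {L : List Lt} (hL : Valid n L) (hD : Dist (1 : Equiv.Perm (Fin n)) L)
    (hW : Dist (1 : Equiv.Perm (Fin n)) (ws L))
    (ht : ∀ l ∈ L, l.2.1 = false → l.2.2 ≠ 0) {a b c : Mat n}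
    (hU : UDL ((gg n L)ᵀ * sd n (ws L)) a b c) {zing : Mat n}
    (hz : zing = (sd n (ws L) * b * c * (sd n (ws L))⁻¹)ᵀ) :
    IsBm zing ∧ (IsBm aᵀ ∧ gg n L = zing * sd n (ws L) * aᵀ) ∧
    (∀ I, UpC I → minor zingᵀ (I.image (sp n (ws L))) (I.image (sp n L)) = 1) ∧
    ∀ L1 L2, L = L1 ++ L2 → ∀ I P, UpC I → DnC P → P = Iᶜ →
      minor zingᵀ (I.image (sp n (ws L1))) (I.image (sp n L1)) =
      minor a (P.image ((sp n L2)⁻¹ : Equiv.Perm (Fin n)))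
        (P.image ((sp n (ws L2))⁻¹ : Equiv.Perm (Fin n))) := by
  obtain ⟨a', b', c', hU', hsuf⟩ := udl_exists hL hW ht
  obtain ⟨ha, hb, hc, e⟩ := hU
  obtain ⟨ha', hb', hc', e'⟩ := hU'
  have hbc : LT (b * c) := hb.lt.mul hc.2
  have hcd : c.det = 1 := by rw [LT.det hc.2]; simp [hc.1]
  have haa : a = a' := by
    refine ud_unique ha ha' hbc ?_ (LT.mul hb'.lt hc'.2) ?_
    · rw [Matrix.det_mul, hb.1, hcd, one_mul]
    · rw [← mul_assoc, ← mul_assoc, ← e, ← e']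
  subst haa
  have hs := sp_sd (n := n) hL.ws
  have hinv : (sd n (ws L))⁻¹ = (sd n (ws L))ᵀ := Matrix.inv_eq_right_inv hs.mul_tr
  have hat : LT aᵀ := UT.tr ha.2
  have hatd : aᵀ.det = 1 := by rw [Matrix.det_transpose]; exact ha.det
  have hgz : gg n L = zing * sd n (ws L) * aᵀ := by
    have h1 : (gg n L)ᵀ = a * b * c * (sd n (ws L))ᵀ := by
      rw [← e, mul_assoc, hs.mul_tr, mul_one]
    have h2 := congrArg Matrix.transpose h1
    rw [Matrix.transpose_transpose] at h2
    rw [h2, hz, hinv]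
    simp only [Matrix.transpose_mul, Matrix.transpose_transpose, mul_assoc]
    rw [← mul_assoc (sd n (ws L))ᵀ, hs.tr_mul, one_mul]
  have hDz : ∀ L1 L2, L = L1 ++ L2 → ∃ D, LT D ∧ D.det = 1 ∧
      gg n L2 = D * (sd n (ws L2) * aᵀ) ∧ zing * sd n (ws L1) = gg n L1 * D := by
    intro L1 L2 h
    obtain ⟨D, hDl, e3⟩ := hsuf L1 L2 h
    subst h
    have hs2 := sp_sd (n := n) hL.right.ws
    refine ⟨D, hDl, ?_, e3, ?_⟩
    · have := congrArg Matrix.det e3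
      rw [Matrix.det_mul, Matrix.det_mul, hatd, det_gg hL.right, det_sd hL.right.ws] at this
      simpa using this.symm
    · rw [gg_append, e3, ws_append, sd_append] at hgz
      have h5 := congrArg (fun X => X * (aᵀ)⁻¹ * (sd n (ws L2))ᵀ) hgz
      simp only [mul_assoc] at h5
      rw [← mul_assoc aᵀ, mul_inv_of_det hatd, one_mul, hs2.mul_tr, mul_one, mul_one] at h5
      exact h5.symm
  obtain ⟨D0, hD0, hD0d, -, e0⟩ := hDz [] L rfl
  have hz0 : zing = D0 := by simpa [ws, sd_nil, gg_nil] using e0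
  refine ⟨⟨by rw [hz0]; exact hD0d, by rw [hz0]; exact hD0⟩, ⟨⟨hatd, hat⟩, hgz⟩, ?_, ?_⟩
  · intro I hI
    rw [minor_tr, ← minor_sd hL.ws hW hI]
    have : zing * sd n (ws L) = gg n L * (aᵀ)⁻¹ := by
      rw [hgz, mul_assoc _ aᵀ, mul_inv_of_det hatd, mul_one]
    have hn : IsN (a⁻¹) := ha.inv
    rw [this, minor_mul _ _ _ _ (upC_lt hI (hat.inv hatd)), minor_gg hL hD hI, one_mul,
      ← Matrix.transpose_nonsing_inv, minor_tr, minor_isN hn]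
  · intro L1 L2 h I P hI hP hPI
    obtain ⟨D, hDl, hDd, e3, e4⟩ := hDz L1 L2 h
    subst h
    have hs2 := sp_sd (n := n) hL.right.ws
    have hL2 := hL.right
    have hD2 := Dist.right hL hD
    rw [ws_append] at hW
    have hW2 := Dist.right (by rw [← ws_append]; exact hL.ws) hW
    rw [minor_tr, ← minor_sd hL.left.ws hW.left hI, e4, minor_mul _ _ _ _ (upC_lt hI hDl),
      minor_gg hL.left hD.left hI, one_mul, minor_lt hDl]
    obtain ⟨u, hu, e5⟩ := gg_unip' hL2 hD2
    have hui := hu.inv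
    rw [← minor_tr, ← minor_sd_tr' hL2 hD2 hP]
    have hv2 := sp_sd (n := n) hL2
    have e6 : aᵀ * (sd n L2)ᵀ * u⁻¹ = (sd n (ws L2))ᵀ * D⁻¹ := by
      have e7 : u * sd n L2 = D * (sd n (ws L2) * aᵀ) := by rw [← e5, e3]
      have e8 : D⁻¹ * u * sd n L2 = sd n (ws L2) * aᵀ := by
        rw [mul_assoc, e7, ← mul_assoc, inv_mul_of_det hDd, one_mul]
      have e9 : aᵀ = (sd n (ws L2))ᵀ * (D⁻¹ * u * sd n L2) := by
        rw [e8, ← mul_assoc, hs2.tr_mul, one_mul]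
      rw [e9]
      simp only [mul_assoc]
      rw [← mul_assoc (sd n L2), hv2.mul_tr, one_mul, mul_inv_of_det hu.det, mul_one]
    have e10 : minor (aᵀ * (sd n L2)ᵀ) (P.image ((sp n (ws L2))⁻¹ : Equiv.Perm (Fin n))) P =
        minor (aᵀ * (sd n L2)ᵀ * u⁻¹) (P.image ((sp n (ws L2))⁻¹ : Equiv.Perm (Fin n))) P := by
      rw [minor_mul _ _ _ _ (dnC_ut hP hui.2), minor_isN hui, mul_one]
    rw [e10, e6, ← minor_tr, ← minor_sd_tr' hL2.ws hW2 hP, Matrix.transpose_mul,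
      Matrix.transpose_transpose, mul_assoc, hs2.mul_tr, mul_one, minor_tr,
      minor_lt (hDl.inv hDd)]
    have hdiag : ∀ i, D i i * D⁻¹ i i = 1 := by
      intro i
      rw [← LT.mul_diag hDl (hDl.inv hDd), mul_inv_of_det hDd, Matrix.one_apply_eq]
    have hprod : (∏ j ∈ I, D j j) * ∏ j ∈ P, D j j = 1 := by
      rw [hPI, Finset.prod_mul_prod_compl, ← hDl.det, hDd]
    have hprod2 : (∏ j ∈ P, D j j) * ∏ j ∈ P, D⁻¹ j j = 1 := by
      rw [← Finset.prod_mul_distrib]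
      exact Finset.prod_eq_one fun j _ => hdiag j
    calc (∏ j ∈ I, D j j) = (∏ j ∈ I, D j j) * ((∏ j ∈ P, D j j) * ∏ j ∈ P, D⁻¹ j j) := by
          rw [hprod2, mul_one]
      _ = _ := by rw [← mul_assoc, hprod, one_mul]

/-! ### Translation -/

def LL (ii : Fin m → ℕ) (v : Equiv.Perm (Fin n)) (t : Fin m → ℝ) : List Lt :=
  List.ofFn fun r => (ii r, !decide (inJ ii v r), t r)

lemma LL_sp (ii : Fin m → ℕ) (v : Equiv.Perm (Fin n)) (t : Fin m → ℝ) :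
    svPermList ii v = (LL ii v t).map (spL n) := by
  unfold svPermList LL
  rw [List.map_ofFn]
  congr 1
  funext r
  by_cases h : inJ ii v r <;> simp [spL, h]

lemma LL_gg (ii : Fin m → ℕ) (v : Equiv.Perm (Fin n)) (t : Fin m → ℝ) :
    mrgList ii v t = (LL ii v t).map (gL n) := by
  unfold mrgList LL
  rw [List.map_ofFn]
  congr 1
  funext r
  by_cases h : inJ ii v r <;> simp [gL, h]

lemma LL_wsp (ii : Fin m → ℕ) (v : Equiv.Perm (Fin n)) (t : Fin m → ℝ) :
    sPermList n ii = (ws (LL ii v t)).map (spL n) := by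
  unfold sPermList LL ws
  rw [List.map_ofFn, List.map_ofFn]
  congr 1

lemma LL_sd (ii : Fin m → ℕ) (v : Equiv.Perm (Fin n)) (t : Fin m → ℝ) :
    (sdotList n ii : List (Mat n)) = (ws (LL ii v t)).map (sdL n) := by
  unfold sdotList LL ws
  rw [List.map_ofFn, List.map_ofFn]
  congr 1

lemma spL_inv (l : Lt) : (spL n l)⁻¹ = spL n l := by
  unfold spL
  split_ifs
  · exact sperm_inv _
  · exact inv_one

lemma sp_rev (L : List Lt) : ((L.map (spL n)).reverse).prod = (sp n L)⁻¹ := by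
  induction L with
  | nil => simp [sp_nil]
  | cons l L ih =>
    rw [sp_cons, List.map_cons, List.reverse_cons, List.prod_append, ih, _root_.mul_inv_rev,
      spL_inv]
    simp

lemma LL_dist {ii : Fin m → ℕ} (hii : ∀ r, 1 ≤ ii r ∧ ii r < n) (v : Equiv.Perm (Fin n))
    (t : Fin m → ℝ) (k : ℕ) (hk : k ≤ m) :
    Dist (vseq ii v k) ((LL ii v t).drop (m - k)) ∧
      vseq ii v k * sp n ((LL ii v t).drop (m - k)) = v := by
  induction k with
  | zero =>
    have : (LL ii v t).drop (m - 0) = [] := by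
      apply List.drop_eq_nil_of_le; simp [LL]
    rw [this]
    exact ⟨trivial, by simp [sp_nil, vseq]⟩
  | succ k ih =>
    obtain ⟨h1, h2⟩ := ih (by omega)
    have hr : m - k - 1 < m := by omega
    have hlen : m - k - 1 < (LL ii v t).length := by simp [LL]; omega
    have hdrop : (LL ii v t).drop (m - (k + 1)) =
        (ii ⟨m - k - 1, hr⟩, !decide (inJ ii v ⟨m - k - 1, hr⟩), t ⟨m - k - 1, hr⟩) ::
          (LL ii v t).drop (m - k) := by
      rw [show m - (k + 1) = m - k - 1 by omega, List.drop_eq_getElem_cons hlen,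
        show m - k - 1 + 1 = m - k by omega]
      congr 1
      simp [LL]
    have hJ : inJ ii v ⟨m - k - 1, hr⟩ ↔ vseq ii v (k + 1) = vseq ii v k := by
      unfold inJ
      simp only
      rw [show m - (m - k - 1) = k + 1 by omega, Nat.add_sub_cancel]
    have hv : vseq ii v (k + 1) = if len (vseq ii v k * sperm n (ii ⟨m - k - 1, hr⟩)) <
        len (vseq ii v k) then vseq ii v k * sperm n (ii ⟨m - k - 1, hr⟩) else vseq ii v k := by
      rw [vseq, dif_pos hr]
    have hi := hii ⟨m - k - 1, hr⟩
    rw [hdrop, sp_cons]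
    generalize ii ⟨m - k - 1, hr⟩ = i at *
    by_cases hc : len (vseq ii v k * sperm n i) < len (vseq ii v k)
    · rw [if_pos hc] at hv
      have hnJ : ¬ inJ ii v ⟨m - k - 1, hr⟩ := by
        rw [hJ, hv]; intro h; rw [h] at hc; exact lt_irrefl _ hc
      have hs : spL n (i, !decide (inJ ii v ⟨m - k - 1, hr⟩), t ⟨m - k - 1, hr⟩) = sperm n i := by
        simp [spL, hnJ]
      have hb : vseq ii v k * sperm n i * sperm n i = vseq ii v k := by
        rw [mul_assoc, sperm_sq, mul_one]
      rw [hv]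
      refine ⟨⟨asc_of_len hi ?_, ?_⟩, ?_⟩
      · rw [hb]; exact not_lt.mpr hc.le
      · rw [hs, hb]; exact h1
      · rw [hs, ← mul_assoc, hb]; exact h2
    · rw [if_neg hc] at hv
      have hnJ : inJ ii v ⟨m - k - 1, hr⟩ := by rw [hJ, hv]
      have hs : spL n (i, !decide (inJ ii v ⟨m - k - 1, hr⟩), t ⟨m - k - 1, hr⟩) = 1 := by
        simp [spL, hnJ]
      rw [hv]
      refine ⟨⟨asc_of_len hi hc, ?_⟩, ?_⟩
      · rw [hs, mul_one]; exact h1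
      · rw [hs, one_mul]; exact h2

/-- comparison of the Leclerc and Ingermanson minors (Theorem 9.9, type A). -/
theorem statement_19 {n m : ℕ} (hn : 1 ≤ n) (ii : Fin m → ℕ)
    (hii : ∀ r, 1 ≤ ii r ∧ ii r < n)
    (w : Equiv.Perm (Fin n)) (hw : w = (sPermList n ii).prod) (hred : len w = m)
    (v : Equiv.Perm (Fin n)) (hv0 : vseq ii v m = 1)
    (t : Fin m → ℝ) (ht : ∀ r, inJ ii v r → 0 < t r) :
    (∃ a b c, UDL ((mrg ii v t)ᵀ * wMR n ii) a b c) ∧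
    ∀ a b c, UDL ((mrg ii v t)ᵀ * wMR n ii) a b c →
      let zing := ((wMR n ii : Matrix (Fin n) (Fin n) ℝ) * b * c *
        (wMR n ii : Matrix (Fin n) (Fin n) ℝ)⁻¹)ᵀ
      IsBm zing ∧
      (∃ bb : Matrix (Fin n) (Fin n) ℝ, IsBm bb ∧ mrg ii v t = zing * wMR n ii * bb) ∧
      (∀ i : ℕ, 1 ≤ i → i ≤ n - 1 →
        minor zingᵀ
          ((univ.filter fun x : Fin n => i ≤ (x : ℕ)).image ⇑w)
          ((univ.filter fun x : Fin n => i ≤ (x : ℕ)).image ⇑v) = 1) ∧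
      ∀ r : Fin m,
        minor zingᵀ
          ((univ.filter fun x : Fin n => ii r ≤ (x : ℕ)).image
            ⇑(((sPermList n ii).take (r : ℕ)).prod))
          ((univ.filter fun x : Fin n => ii r ≤ (x : ℕ)).image
            ⇑(((svPermList ii v).take (r : ℕ)).prod))
        =
        minor a
          ((univ.filter fun x : Fin n => (x : ℕ) < ii r).image
            ⇑(((svPermList ii v).drop (r : ℕ)).reverse.prod))
          ((univ.filter fun x : Fin n => (x : ℕ) < ii r).image
            ⇑(((sPermList n ii).drop (r : ℕ)).reverse.prod)) := by
  have hL : Valid n (LL ii v t) := by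
    intro l hl
    rw [LL, List.mem_ofFn] at hl
    obtain ⟨r, rfl⟩ := hl
    exact hii r
  have ht' : ∀ l ∈ LL ii v t, l.2.1 = false → l.2.2 ≠ 0 := by
    intro l hl
    rw [LL, List.mem_ofFn] at hl
    obtain ⟨r, rfl⟩ := hl
    intro h
    exact (ht r (by simpa using h)).ne'
  have hwL : w = sp n (ws (LL ii v t)) := by rw [hw, LL_wsp ii v t, sp]
  have hW : Dist (1 : Equiv.Perm (Fin n)) (ws (LL ii v t)) := by
    apply dist_of_reduced hL
    rw [one_mul, ← hwL, hred, len_one, LL, List.length_ofFn, zero_add]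
  obtain ⟨hD, hvL⟩ := LL_dist hii v t m le_rfl
  rw [hv0, Nat.sub_self, List.drop_zero] at hD hvL
  rw [one_mul] at hvL
  have hg : mrg ii v t = gg n (LL ii v t) := by rw [mrg, LL_gg, gg]
  have hsd : (wMR n ii : Mat n) = sd n (ws (LL ii v t)) := by rw [wMR, LL_sd ii v t, sd]
  rw [hg, hsd]
  refine ⟨?_, ?_⟩
  · obtain ⟨a, b, c, h, -⟩ := udl_exists hL hW ht'
    exact ⟨a, b, c, h⟩
  · intro a b c hU zing
    obtain ⟨h1, h2, h3, h4⟩ := main_list hL hD hW ht' hU (zing := zing) rfl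
    refine ⟨h1, ⟨_, h2.1, h2.2⟩, ?_, ?_⟩
    · intro i _ _
      have := h3 (univ.filter fun x : Fin n => i ≤ (x : ℕ)) (by
        intro p q hpq hp
        rw [Finset.mem_filter] at hp ⊢
        exact ⟨Finset.mem_univ _, hp.2.trans (Fin.lt_def.1 hpq).le⟩)
      rw [← hwL, hvL] at this
      exact this
    · intro r
      have := h4 ((LL ii v t).take r) ((LL ii v t).drop r) (List.take_append_drop _ _).symm
        (univ.filter fun x : Fin n => ii r ≤ (x : ℕ))
        (univ.filter fun x : Fin n => (x : ℕ) < ii r) (by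
          intro p q hpq hp
          rw [Finset.mem_filter] at hp ⊢
          exact ⟨Finset.mem_univ _, hp.2.trans (Fin.lt_def.1 hpq).le⟩) (by
          intro p q hpq hp
          rw [Finset.mem_filter] at hp ⊢
          exact ⟨Finset.mem_univ _, (Fin.lt_def.1 hpq).trans hp.2⟩) (by
          ext x
          simp)
      rw [LL_wsp ii v t, LL_sp ii v t, ← List.map_take, ← List.map_take, ← List.map_drop,
        ← List.map_drop, sp_rev, sp_rev]
      have e1 : (ws (LL ii v t)).take r = ws ((LL ii v t).take r) := by
        rw [ws, ws, List.map_take]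
      have e2 : (ws (LL ii v t)).drop r = ws ((LL ii v t).drop r) := by
        rw [ws, ws, List.map_drop]
      rw [e1, e2]
      exact this

end
end Paper
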